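/- Let d ∈ {3,4} and let P be the law of a random traps environment ρ = (ρ_x)_{x∈ℤ^d} which is stationary under the shifts of ℤ^d and satisfies E[π_ρ(0)] < ∞, where π_ρ(x) = (1−ρ_x)^{-1}. For R > 0 set A^R_ρ = {x ∈ ℤ^d : π_ρ(x) ≥ R·max(|x|,1)²}. Then there exist R > 0, c > 0 and an integer K ≥ 1 such that for all n ≥ 2 and all x ∈ ℤ^d with n/2 ≤ |x| ≤ n: E[ g̃^{Kn}_R(0,x) ] ≥ c |x|^{2−d}, where g̃^{Kn}_R denotes the Green's function of the trap walk killed upon exiting Λ_{Kn} or entering A^R_ρ (the killed Green's function with B = Λ_{Kn} ∖ A^R_ρ). -/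

import Mathlib

open MeasureTheory
open scoped ENNReal NNReal Classical

noncomputable section

/-- The lattice `ℤ^d`. -/
abbrev Zd (d : ℕ) := Fin d → ℤ

/-- Euclidean norm of a lattice point. -/
def znorm {d : ℕ} (x : Zd d) : ℝ := Real.sqrt (∑ i, ((x i : ℝ)) ^ 2)

/-- Matrix powers of a (sub-)stochastic kernel on `ℤ^d`, valued in `[0,∞]`. -/
def kpow {d : ℕ} (p : Zd d → Zd d → ℝ≥0∞) : ℕ → Zd d → Zd d → ℝ≥0∞
  | 0 => fun x y => if x = y then 1 else 0
  | n + 1 => fun x y => ∑' z : Zd d, kpow p n x z * p z y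

/-- Transition kernel of the trap walk with environment `ρ`. -/
def trapK {d : ℕ} (ρ : Zd d → ℝ) (x y : Zd d) : ℝ≥0∞ :=
  if x = y then ENNReal.ofReal (ρ x)
  else if znorm (x - y) = 1 then ENNReal.ofReal ((1 - ρ x) / (2 * d)) else 0

/-- Kernel killed outside the set `B`. -/
def kill {d : ℕ} (p : Zd d → Zd d → ℝ≥0∞) (B : Set (Zd d)) (x y : Zd d) : ℝ≥0∞ :=
  if x ∈ B ∧ y ∈ B then p x y else 0

/-- The box `Λ_m = ℤ^d ∩ [-m,m]^d`. -/
def lamF (d m : ℕ) : Finset (Zd d) := Fintype.piFinset fun _ => Finset.Icc (-(m : ℤ)) (m : ℤ)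

/-- `π_ρ(x) = (1-ρ_x)⁻¹`, as an extended real. -/
def piT {d : ℕ} (ρ : Zd d → ℝ) (x : Zd d) : ℝ≥0∞ := ENNReal.ofReal ((1 - ρ x)⁻¹)

/-- The set `A^R_ρ = {x : π_ρ(x) ≥ R·max(|x|,1)²}` of deep traps. -/
def Atrap {d : ℕ} (R : ℝ) (ρ : Zd d → ℝ) : Set (Zd d) :=
  {x | R * max (znorm x) 1 ^ 2 ≤ (1 - ρ x)⁻¹}

/-- Green's function of the trap walk killed upon exiting `Λ_m` or entering `A^R_ρ`. -/
def gKillTrap {d : ℕ} (ρ : Zd d → ℝ) (R : ℝ) (m : ℕ) (x y : Zd d) : ℝ≥0∞ :=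
  ∑' k : ℕ, kpow (kill (trapK ρ) ((lamF d m : Set (Zd d)) \ Atrap R ρ)) k x y / piT ρ y

/-- The radial profile `t ↦ t^{-(d-2)/2}`, so that `radial d (|x|²) = |x|^{2-d}`. -/
def radial (d : ℕ) (t : ℝ) : ℝ := t ^ (-(((d : ℝ) - 2) / 2))

lemma radial_pos (d : ℕ) {t : ℝ} (ht : 0 < t) : 0 < radial d t := Real.rpow_pos_of_pos ht _

lemma radial_mul (d : ℕ) {s t : ℝ} (hs : 0 ≤ s) (ht : 0 ≤ t) :
    radial d (s * t) = radial d s * radial d t := Real.mul_rpow hs ht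

lemma radial_anti {d : ℕ} (hd : d = 3 ∨ d = 4) {s t : ℝ} (hs : 0 < s) (hst : s ≤ t) :
    radial d t ≤ radial d s := by
  apply Real.rpow_le_rpow_of_nonpos hs hst
  rcases hd with rfl | rfl <;> norm_num

lemma radial_one (d : ℕ) : radial d 1 = 1 := Real.one_rpow _

lemma radial_le_one {d : ℕ} (hd : d = 3 ∨ d = 4) {t : ℝ} (ht : 1 ≤ t) : radial d t ≤ 1 :=
  radial_one d ▸ radial_anti hd one_pos ht

lemma radial_three {t : ℝ} (ht : 0 < t) : radial 3 t = (√t)⁻¹ := by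
  rw [radial, Real.sqrt_eq_rpow, ← Real.rpow_neg ht.le]
  norm_num

lemma radial_four (t : ℝ) : radial 4 t = t⁻¹ := by
  rw [radial, ← Real.rpow_neg_one]
  norm_num

lemma radial_strictAnti {d : ℕ} (hd : d = 3 ∨ d = 4) {s t : ℝ} (hs : 0 < s) (hst : s < t) :
    radial d t < radial d s := by
  apply Real.rpow_lt_rpow_of_neg hs hst
  rcases hd with rfl | rfl <;> norm_num

lemma radial_sq {d : ℕ} {t : ℝ} (ht : 0 ≤ t) : radial d (t ^ 2) = t ^ ((2 : ℝ) - d) := by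
  rw [radial, ← Real.rpow_natCast, ← Real.rpow_mul ht]
  congr 1
  push_cast
  ring

lemma le_inv_sqrt {q t : ℝ} (ht : 0 < t) (h : q ^ 2 * t ≤ 1) : q ≤ (√t)⁻¹ := by
  rw [← Real.sqrt_inv]
  apply Real.le_sqrt_of_sq_le
  rw [← one_div, le_div_iff₀ ht]
  exact h

lemma inv_sqrt_le {q t : ℝ} (ht : 0 < t) (hq : 0 ≤ q) (h : 1 ≤ q ^ 2 * t) : (√t)⁻¹ ≤ q := by
  rw [← Real.sqrt_inv]
  apply Real.sqrt_le_iff.2 ⟨hq, _⟩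
  rw [← one_div, div_le_iff₀ ht]
  exact h

lemma le_inv_sqrt_one_add {y : ℝ} (hy : |y| ≤ 1 / 2) :
    1 - y / 2 + 3 / 8 * y ^ 2 - 5 / 16 * y ^ 3 ≤ (√(1 + y))⁻¹ := by
  obtain ⟨h1, h2⟩ := abs_le.1 hy
  apply le_inv_sqrt (by linarith)
  have key : 1 - (1 - y / 2 + 3 / 8 * y ^ 2 - 5 / 16 * y ^ 3) ^ 2 * (1 + y)
      = y ^ 4 * (35 / 64 - 7 / 32 * y + 35 / 256 * y ^ 2 - 25 / 256 * y ^ 3) := by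
    ring
  have : 0 ≤ y ^ 4 * (35 / 64 - 7 / 32 * y + 35 / 256 * y ^ 2 - 25 / 256 * y ^ 3) := by
    apply mul_nonneg (by positivity)
    nlinarith [sq_nonneg y, mul_nonneg (sq_nonneg y) (by linarith : 0 ≤ 1 / 2 - y)]
  linarith

lemma inv_sqrt_one_add_le {y : ℝ} (hy : |y| ≤ 1 / 2) :
    (√(1 + y))⁻¹ ≤ 1 - y / 2 + 3 / 8 * y ^ 2 - 5 / 16 * y ^ 3 + 2 * y ^ 4 := by
  obtain ⟨h1, h2⟩ := abs_le.1 hy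
  have hq : 0 ≤ 1 - y / 2 + 3 / 8 * y ^ 2 - 5 / 16 * y ^ 3 := by
    nlinarith [sq_nonneg y, mul_nonneg (sq_nonneg y) (by linarith : 0 ≤ 1 / 2 - y)]
  apply inv_sqrt_le (by linarith) (by positivity)
  have key : (1 - y / 2 + 3 / 8 * y ^ 2 - 5 / 16 * y ^ 3 + 2 * y ^ 4) ^ 2 * (1 + y) - 1
      = y ^ 4 * (4 * (1 + y / 2 - y ^ 2 / 8 + y ^ 3 / 16 - 5 / 16 * y ^ 4)
        - (35 / 64 - 7 / 32 * y + 35 / 256 * y ^ 2 - 25 / 256 * y ^ 3)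
        + 4 * y ^ 4 * (1 + y)) := by
    ring
  have hsq : y ^ 2 ≤ 1 / 4 := by nlinarith
  have : 0 ≤ y ^ 4 * (4 * (1 + y / 2 - y ^ 2 / 8 + y ^ 3 / 16 - 5 / 16 * y ^ 4)
        - (35 / 64 - 7 / 32 * y + 35 / 256 * y ^ 2 - 25 / 256 * y ^ 3)
        + 4 * y ^ 4 * (1 + y)) := by
    apply mul_nonneg (by positivity)
    have h4 : y ^ 4 ≤ 1 / 16 := by nlinarith [sq_nonneg y]
    have h5 : 0 ≤ 4 * y ^ 4 * (1 + y) := mul_nonneg (by positivity) (by linarith)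
    nlinarith [mul_nonneg (sq_nonneg y) (by linarith : 0 ≤ 1 / 2 + y), sq_nonneg y]
  linarith

lemma radial_pair_lower {d : ℕ} (hd : d = 3 ∨ d = 4) {y : ℝ} (hy : |y| ≤ 1 / 2) :
    2 + (d : ℝ) * (d - 2) / 4 * y ^ 2 ≤ radial d (1 + y) + radial d (1 - y) := by
  obtain ⟨h1, h2⟩ := abs_le.1 hy
  rcases hd with rfl | rfl
  · rw [radial_three (by linarith), radial_three (by linarith)]
    have h3 := le_inv_sqrt_one_add hy
    have h4 := le_inv_sqrt_one_add (y := -y) (by rwa [abs_neg])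
    rw [← sub_eq_add_neg] at h4
    push_cast
    nlinarith
  · rw [radial_four, radial_four]
    have e : (1 + y)⁻¹ + (1 - y)⁻¹ = 2 + 2 * y ^ 2 + 2 * y ^ 4 / ((1 + y) * (1 - y)) := by
      have : 1 + y ≠ 0 := by linarith
      have : 1 - y ≠ 0 := by linarith
      field_simp
      ring
    have : 0 ≤ 2 * y ^ 4 / ((1 + y) * (1 - y)) :=
      div_nonneg (by positivity) (mul_nonneg (by linarith) (by linarith))
    rw [e]
    push_cast
    linarith

lemma radial_pair_upper {d : ℕ} (hd : d = 3 ∨ d = 4) {y : ℝ} (hy : |y| ≤ 1 / 2) :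
    radial d (1 + y) + radial d (1 - y) ≤ 2 + (d : ℝ) * (d - 2) / 4 * y ^ 2 + 4 * y ^ 4 := by
  obtain ⟨h1, h2⟩ := abs_le.1 hy
  rcases hd with rfl | rfl
  · rw [radial_three (by linarith), radial_three (by linarith)]
    have h3 := inv_sqrt_one_add_le hy
    have h4 := inv_sqrt_one_add_le (y := -y) (by rwa [abs_neg])
    rw [← sub_eq_add_neg] at h4
    push_cast
    nlinarith
  · rw [radial_four, radial_four]
    have e : (1 + y)⁻¹ + (1 - y)⁻¹ = 2 + 2 * y ^ 2 + 2 * y ^ 4 / ((1 + y) * (1 - y)) := by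
      have : 1 + y ≠ 0 := by linarith
      have : 1 - y ≠ 0 := by linarith
      field_simp
      ring
    have : 2 * y ^ 4 / ((1 + y) * (1 - y)) ≤ 4 * y ^ 4 := by
      rw [div_le_iff₀ (mul_pos (by linarith) (by linarith))]
      have : 0 ≤ y ^ 4 * (1 - 2 * y ^ 2) := mul_nonneg (by positivity) (by nlinarith)
      nlinarith
    rw [e]
    push_cast
    linarith

lemma radial_one_sub_lower {d : ℕ} (hd : d = 3 ∨ d = 4) {z : ℝ} (h0 : 0 ≤ z) (h1 : z ≤ 1 / 2) :
    1 + ((d : ℝ) - 2) / 2 * z ≤ radial d (1 - z) := by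
  rcases hd with rfl | rfl
  · rw [radial_three (by linarith)]
    apply le_inv_sqrt (by linarith)
    push_cast
    nlinarith [mul_nonneg h0 h0, mul_nonneg (mul_nonneg h0 h0) h0]
  · rw [radial_four, ← one_div, le_div_iff₀ (by linarith)]
    push_cast
    nlinarith

lemma radial_one_sub_upper {d : ℕ} (hd : d = 3 ∨ d = 4) {z : ℝ} (h0 : 0 ≤ z) (h1 : z ≤ 1 / 2) :
    radial d (1 - z) ≤ 1 + ((d : ℝ) - 2) / 2 * z + 2 * z ^ 2 := by
  rcases hd with rfl | rfl
  · rw [radial_three (by linarith)]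
    push_cast
    apply inv_sqrt_le (by linarith) (by nlinarith)
    have : (1 + ((3 : ℝ) - 2) / 2 * z + 2 * z ^ 2) ^ 2 * (1 - z) - 1
        = z ^ 2 * (13 / 4 - 9 / 4 * z + 2 * z ^ 2 - 4 * z ^ 3) := by ring
    have : 0 ≤ z ^ 2 * (13 / 4 - 9 / 4 * z + 2 * z ^ 2 - 4 * z ^ 3) := by
      apply mul_nonneg (by positivity)
      nlinarith [mul_nonneg (sq_nonneg z) (by linarith : 0 ≤ 1 / 2 - z)]
    linarith
  · rw [radial_four, ← one_div, div_le_iff₀ (by linarith)]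
    push_cast
    nlinarith [mul_nonneg (sq_nonneg z) (by linarith : 0 ≤ 1 / 2 - z)]

/-- The squared Euclidean norm of a lattice point. -/
def sqn {d : ℕ} (x : Zd d) : ℝ := ∑ i, ((x i : ℝ)) ^ 2

lemma sqn_nonneg {d : ℕ} (x : Zd d) : 0 ≤ sqn x := Finset.sum_nonneg fun _ _ => sq_nonneg _

lemma sq_le_sqn {d : ℕ} (x : Zd d) (i : Fin d) : (x i : ℝ) ^ 2 ≤ sqn x :=
  Finset.single_le_sum (f := fun i => (x i : ℝ) ^ 2) (fun _ _ => sq_nonneg _) (Finset.mem_univ i)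

lemma sqn_eq_zero {d : ℕ} {x : Zd d} : sqn x = 0 ↔ x = 0 := by
  rw [sqn, Finset.sum_eq_zero_iff_of_nonneg fun _ _ => sq_nonneg _, funext_iff]
  simp

lemma one_le_sqn {d : ℕ} {x : Zd d} (hx : x ≠ 0) : 1 ≤ sqn x := by
  obtain ⟨i, hi⟩ := Function.ne_iff.1 hx
  have h : (1 : ℤ) ≤ (x i) ^ 2 := (by have : x i ≠ 0 := hi; positivity : (0 : ℤ) < (x i) ^ 2)
  have : (1 : ℝ) ≤ (x i : ℝ) ^ 2 := by exact_mod_cast h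
  exact this.trans (sq_le_sqn x i)

lemma znorm_sq {d : ℕ} (x : Zd d) : znorm x ^ 2 = sqn x := Real.sq_sqrt (sqn_nonneg x)

lemma znorm_nonneg {d : ℕ} (x : Zd d) : 0 ≤ znorm x := Real.sqrt_nonneg _

lemma sqn_add_le {d : ℕ} (x y : Zd d) : sqn (x + y) ≤ 2 * (sqn x + sqn y) := by
  simp only [sqn, ← Finset.sum_add_distrib, Finset.mul_sum]
  refine Finset.sum_le_sum fun i _ => ?_
  simp only [Pi.add_apply]
  push_cast
  nlinarith [sq_nonneg ((x i : ℝ) - y i)]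

lemma sqn_add_single {d : ℕ} (x : Zd d) (i : Fin d) (s : ℤ) :
    sqn (x + Pi.single i s) = sqn x + (s : ℝ) ^ 2 + 2 * s * x i := by
  have h : ∀ j, (((x + Pi.single i s : Zd d) j : ℤ) : ℝ) ^ 2
      = (x j : ℝ) ^ 2 + if j = i then (s : ℝ) ^ 2 + 2 * s * x i else 0 := by
    intro j
    by_cases hj : j = i
    · subst hj
      simp only [Pi.add_apply, Pi.single_eq_same, if_true]
      push_cast
      ring
    · simp [hj]
  rw [sqn, Finset.sum_congr rfl fun j _ => h j, Finset.sum_add_distrib]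
  simp [sqn, add_assoc]

lemma sqn_add_one {d : ℕ} (x : Zd d) (i : Fin d) :
    sqn (x + Pi.single i 1) = sqn x + 1 + 2 * x i := by
  rw [sqn_add_single]
  push_cast
  ring

lemma sqn_sub_one {d : ℕ} (x : Zd d) (i : Fin d) :
    sqn (x - Pi.single i 1) = sqn x + 1 - 2 * x i := by
  rw [sub_eq_add_neg, ← Pi.single_neg, sqn_add_single]
  push_cast
  ring

/-- The sum of `F` over the `2d` nearest neighbours of `x`. -/
def nbSum {d : ℕ} (F : Zd d → ℝ) (x : Zd d) : ℝ :=
  ∑ i, (F (x + Pi.single i 1) + F (x - Pi.single i 1))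

lemma nbSum_const {d : ℕ} (c : ℝ) (x : Zd d) : nbSum (fun _ => c) x = 2 * d * c := by
  simp [nbSum]
  ring

lemma nbSum_sub {d : ℕ} (F G : Zd d → ℝ) (x : Zd d) :
    nbSum (fun z => F z - G z) x = nbSum F x - nbSum G x := by
  simp only [nbSum, ← Finset.sum_sub_distrib]
  exact Finset.sum_congr rfl fun i _ => by ring

lemma nbSum_const_mul {d : ℕ} (c : ℝ) (F : Zd d → ℝ) (x : Zd d) :
    nbSum (fun z => c * F z) x = c * nbSum F x := by
  simp only [nbSum, Finset.mul_sum]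
  exact Finset.sum_congr rfl fun i _ => by ring

lemma nbSum_sum {d : ℕ} {ι : Type*} (s : Finset ι) (F : ι → Zd d → ℝ) (x : Zd d) :
    nbSum (fun z => ∑ a ∈ s, F a z) x = ∑ a ∈ s, nbSum (F a) x := by
  simp only [nbSum, ← Finset.sum_add_distrib]
  exact Finset.sum_comm

lemma nbSum_comp_sub {d : ℕ} (F : Zd d → ℝ) (a x : Zd d) :
    nbSum (fun z => F (z - a)) x = nbSum F (x - a) := by
  simp only [nbSum]
  refine Finset.sum_congr rfl fun i _ => ?_
  rw [add_sub_right_comm, sub_right_comm]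

/-- A smoothed version of `|x|^{2-d}` which is superharmonic for the simple random walk. -/
def superPot (d : ℕ) (x : Zd d) : ℝ := radial d (sqn x + 64)

lemma superPot_pos {d : ℕ} (x : Zd d) : 0 < superPot d x :=
  radial_pos d (by linarith [sqn_nonneg x])

lemma abs_two_mul_div_le {t v : ℝ} (ht : 0 < t) (h : 4 * |v| ≤ t) : |2 * v / t| ≤ 1 / 2 := by
  rw [abs_div, abs_mul, abs_of_pos ht, abs_two, div_le_iff₀ ht]
  linarith

lemma radial_add_sub {d : ℕ} {t v : ℝ} (ht : 0 < t) (h : 4 * |v| ≤ t) :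
    radial d (t + 2 * v) + radial d (t - 2 * v)
      = radial d t * (radial d (1 + 2 * v / t) + radial d (1 - 2 * v / t)) := by
  have hy := abs_le.1 (abs_two_mul_div_le ht h)
  rw [mul_add, ← radial_mul d ht.le (by linarith), ← radial_mul d ht.le (by linarith)]
  congr 2 <;> field_simp

lemma sum_pow_four_le {d : ℕ} (x : Zd d) : ∑ i, (x i : ℝ) ^ 4 ≤ sqn x ^ 2 := by
  calc ∑ i, (x i : ℝ) ^ 4 ≤ ∑ i, (x i : ℝ) ^ 2 * sqn x := by
        refine Finset.sum_le_sum fun i _ => ?_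
        nlinarith [sq_le_sqn x i, sq_nonneg (x i : ℝ)]
    _ = sqn x ^ 2 := by rw [← Finset.sum_mul, sq (sqn x)]; rfl

lemma nbSum_superPot_le {d : ℕ} (hd : d = 3 ∨ d = 4) (x : Zd d) :
    nbSum (superPot d) x ≤ 2 * d * superPot d x := by
  set r := sqn x with hr
  have hr0 : 0 ≤ r := sqn_nonneg x
  set t := r + 65 with ht
  have ht0 : 0 < t := by linarith
  have hdd : (3 : ℝ) ≤ d := by rcases hd with rfl | rfl <;> norm_num
  have hx : ∀ i, 4 * |(x i : ℝ)| ≤ t := fun i => by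
    have := sq_le_sqn x i
    rw [← sq_abs] at this
    nlinarith [sq_nonneg (|(x i : ℝ)| - 2)]
  have h1 : nbSum (superPot d) x
      ≤ radial d t * (2 * d + d * (d - 2) * r / t ^ 2 + 64 * r ^ 2 / t ^ 4) := by
    calc nbSum (superPot d) x
        = ∑ i, (radial d (t + 2 * x i) + radial d (t - 2 * x i)) := by
          refine Finset.sum_congr rfl fun i _ => ?_
          rw [superPot, superPot, sqn_add_one, sqn_sub_one]
          congr 2 <;> rw [ht] <;> ring
      _ ≤ ∑ i, radial d t * (2 + (d : ℝ) * (d - 2) / t ^ 2 * (x i : ℝ) ^ 2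
            + 64 / t ^ 4 * (x i : ℝ) ^ 4) := by
          refine Finset.sum_le_sum fun i _ => ?_
          rw [radial_add_sub ht0 (hx i)]
          refine mul_le_mul_of_nonneg_left ?_ (radial_pos d ht0).le
          refine (radial_pair_upper hd (abs_two_mul_div_le ht0 (hx i))).trans (le_of_eq ?_)
          field_simp
          ring
      _ = radial d t * (2 * d + d * (d - 2) / t ^ 2 * r + 64 / t ^ 4 * ∑ i, (x i : ℝ) ^ 4) := by
          rw [← Finset.mul_sum, Finset.sum_add_distrib, Finset.sum_add_distrib, ← Finset.mul_sum,
            ← Finset.mul_sum]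
          simp only [Finset.sum_const, Finset.card_univ, Fintype.card_fin, nsmul_eq_mul]
          rw [mul_comm (d : ℝ) 2]
          rfl
      _ ≤ _ := by
          refine mul_le_mul_of_nonneg_left ?_ (radial_pos d ht0).le
          have := mul_le_mul_of_nonneg_left (sum_pow_four_le x) (by positivity : 0 ≤ 64 / t ^ 4)
          rw [← hr] at this
          have e1 : (d : ℝ) * (d - 2) / t ^ 2 * r = d * (d - 2) * r / t ^ 2 := by ring
          have e2 : 64 / t ^ 4 * r ^ 2 = 64 * r ^ 2 / t ^ 4 := by ring
          linarith
  have h2 : radial d t * (1 + ((d : ℝ) - 2) / 2 * (1 / t)) ≤ superPot d x := by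
    have hz : 1 / t ≤ 1 / 2 := one_div_le_one_div_of_le (by norm_num) (by linarith)
    have e : sqn x + 64 = t * (1 - 1 / t) := by field_simp; rw [ht]; ring
    rw [superPot, e, radial_mul d ht0.le (by linarith)]
    exact mul_le_mul_of_nonneg_left (radial_one_sub_lower hd (by positivity) hz)
      (radial_pos d ht0).le
  have h3 : 2 * (d : ℝ) + d * (d - 2) * r / t ^ 2 + 64 * r ^ 2 / t ^ 4
      ≤ 2 * d * (1 + ((d : ℝ) - 2) / 2 * (1 / t)) := by
    have h4 : 64 * r ^ 2 / t ^ 4 ≤ 64 / t ^ 2 := by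
      rw [div_le_div_iff₀ (by positivity) (by positivity)]
      have : r ^ 2 ≤ t ^ 2 := by nlinarith
      nlinarith [mul_le_mul_of_nonneg_right this (by positivity : 0 ≤ 64 * t ^ 2)]
    have h5 : 2 * (d : ℝ) * (1 + ((d : ℝ) - 2) / 2 * (1 / t)) - (2 * (d : ℝ)
        + d * (d - 2) * r / t ^ 2 + 64 / t ^ 2) = (d * (d - 2) * 65 - 64) / t ^ 2 := by
      field_simp
      rw [ht]
      ring
    have h6 : 0 ≤ ((d : ℝ) * (d - 2) * 65 - 64) / t ^ 2 := by
      apply div_nonneg _ (by positivity)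
      nlinarith
    linarith
  calc _ ≤ _ := h1
    _ ≤ radial d t * (2 * d * (1 + ((d : ℝ) - 2) / 2 * (1 / t))) :=
        mul_le_mul_of_nonneg_left h3 (radial_pos d ht0).le
    _ = 2 * d * (radial d t * (1 + ((d : ℝ) - 2) / 2 * (1 / t))) := by ring
    _ ≤ _ := mul_le_mul_of_nonneg_left h2 (by positivity)

lemma nbSum_superPot_zero_lt {d : ℕ} (hd : d = 3 ∨ d = 4) :
    nbSum (superPot d) 0 < 2 * d * superPot d 0 := by
  have hdd : (3 : ℝ) ≤ d := by rcases hd with rfl | rfl <;> norm_num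
  have h0 : sqn (0 : Zd d) = 0 := sqn_eq_zero.2 rfl
  have h1 : nbSum (superPot d) 0 = 2 * d * radial d 65 := by
    simp only [nbSum, superPot, sqn_add_one, sqn_sub_one, h0]
    norm_num
    ring
  have h2 : superPot d 0 = radial d 64 := by rw [superPot, h0, zero_add]
  rw [h1, h2]
  exact mul_lt_mul_of_pos_left (radial_strictAnti hd (by norm_num) (by norm_num)) (by linarith)

/-- A version of `|x|^{2-d}` which is subharmonic away from the origin. -/
def subPot (d : ℕ) (x : Zd d) : ℝ :=
  if 25 ≤ sqn x then radial d (sqn x - 5) else (2 * d : ℝ) ^ (25 - sqn x)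

lemma subPot_pos {d : ℕ} (hd : d = 3 ∨ d = 4) (x : Zd d) : 0 < subPot d x := by
  have hdd : (3 : ℝ) ≤ d := by rcases hd with rfl | rfl <;> norm_num
  rw [subPot]
  split_ifs with h
  · exact radial_pos d (by linarith)
  · exact Real.rpow_pos_of_pos (by linarith) _

lemma radial_le_subPot {d : ℕ} (hd : d = 3 ∨ d = 4) {x : Zd d} {s : ℝ} (hs : 1 ≤ s)
    (h : sqn x - 5 ≤ s) : radial d s ≤ subPot d x := by
  have hdd : (3 : ℝ) ≤ d := by rcases hd with rfl | rfl <;> norm_num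
  rw [subPot]
  split_ifs with h'
  · exact radial_anti hd (by linarith) h
  · exact (radial_le_one hd hs).trans (Real.one_le_rpow (by linarith) (by linarith))

lemma subPot_le_nbSum_of_le {d : ℕ} (hd : d = 3 ∨ d = 4) {x : Zd d} (hr25 : 25 ≤ sqn x) :
    2 * d * subPot d x ≤ nbSum (subPot d) x := by
  have hdd : (3 : ℝ) ≤ d := by rcases hd with rfl | rfl <;> norm_num
  set r := sqn x with hr
  set t := r - 4 with ht
  have ht0 : 0 < t := by linarith
  have hx : ∀ i, 4 * |(x i : ℝ)| ≤ t := fun i => by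
    have := sq_le_sqn x i
    rw [← sq_abs] at this
    nlinarith [sq_nonneg (|(x i : ℝ)| - 5)]
  have h1 : radial d t * (2 * d + d * (d - 2) / t ^ 2 * r) ≤ nbSum (subPot d) x := by
    calc radial d t * (2 * d + d * (d - 2) / t ^ 2 * r)
        = ∑ i, radial d t * (2 + (d : ℝ) * (d - 2) / t ^ 2 * (x i : ℝ) ^ 2) := by
          rw [← Finset.mul_sum, Finset.sum_add_distrib, ← Finset.mul_sum]
          simp only [Finset.sum_const, Finset.card_univ, Fintype.card_fin, nsmul_eq_mul]
          rw [mul_comm (d : ℝ) 2]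
          rfl
      _ ≤ ∑ i, (radial d (t + 2 * x i) + radial d (t - 2 * x i)) := by
          refine Finset.sum_le_sum fun i _ => ?_
          rw [radial_add_sub ht0 (hx i)]
          refine mul_le_mul_of_nonneg_left ?_ (radial_pos d ht0).le
          refine le_trans (le_of_eq ?_)
            (radial_pair_lower hd (abs_two_mul_div_le ht0 (hx i)))
          field_simp
          ring
      _ ≤ _ := by
          refine Finset.sum_le_sum fun i _ => ?_
          have := hx i
          have h3 := le_abs_self (x i : ℝ)
          have h4 := neg_abs_le (x i : ℝ)
          refine add_le_add (radial_le_subPot hd (by linarith) ?_)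
            (radial_le_subPot hd (by linarith) ?_)
          · rw [sqn_add_one]; linarith
          · rw [sqn_sub_one]; linarith
  have h2 : subPot d x
      ≤ radial d t * (1 + ((d : ℝ) - 2) / 2 * (1 / t) + 2 * (1 / t) ^ 2) := by
    have hz : 1 / t ≤ 1 / 2 := one_div_le_one_div_of_le (by norm_num) (by linarith)
    have e : sqn x - 5 = t * (1 - 1 / t) := by field_simp; rw [ht]; ring
    rw [subPot, if_pos hr25, e, radial_mul d ht0.le (by linarith)]
    exact mul_le_mul_of_nonneg_left (radial_one_sub_upper hd (by positivity) hz)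
      (radial_pos d ht0).le
  have h3 : 2 * d * (1 + ((d : ℝ) - 2) / 2 * (1 / t) + 2 * (1 / t) ^ 2)
      ≤ 2 * d + d * (d - 2) / t ^ 2 * r := by
    have h5 : (2 * (d : ℝ) + d * (d - 2) / t ^ 2 * r)
        - 2 * d * (1 + ((d : ℝ) - 2) / 2 * (1 / t) + 2 * (1 / t) ^ 2)
        = (4 * d * (d - 3)) / t ^ 2 := by
      field_simp
      rw [ht]
      ring
    have h6 : 0 ≤ (4 * (d : ℝ) * (d - 3)) / t ^ 2 := by
      apply div_nonneg _ (by positivity)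
      nlinarith
    linarith
  calc _ ≤ 2 * d * (radial d t * (1 + ((d : ℝ) - 2) / 2 * (1 / t) + 2 * (1 / t) ^ 2)) :=
        mul_le_mul_of_nonneg_left h2 (by positivity)
    _ = radial d t * (2 * d * (1 + ((d : ℝ) - 2) / 2 * (1 / t) + 2 * (1 / t) ^ 2)) := by ring
    _ ≤ _ := mul_le_mul_of_nonneg_left h3 (radial_pos d ht0).le
    _ ≤ _ := h1

lemma mul_subPot_le {d : ℕ} (hd : d = 3 ∨ d = 4) {x y : Zd d} (hx : ¬ 25 ≤ sqn x)
    (hy : sqn y ≤ sqn x - 1) : 2 * d * subPot d x ≤ subPot d y := by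
  have hdd : (3 : ℝ) ≤ d := by rcases hd with rfl | rfl <;> norm_num
  have hpos : (0 : ℝ) < 2 * d := by linarith
  have e : (2 * d : ℝ) * (2 * d : ℝ) ^ (25 - sqn x) = (2 * d : ℝ) ^ (25 - sqn x + 1) := by
    rw [Real.rpow_add hpos, Real.rpow_one, mul_comm]
  rw [subPot, subPot, if_neg hx, if_neg (by linarith), e]
  exact Real.rpow_le_rpow_of_exponent_le (by linarith) (by linarith)

lemma add_le_nbSum {d : ℕ} {F : Zd d → ℝ} (hF : ∀ y, 0 ≤ F y) (x : Zd d) (i : Fin d) :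
    F (x + Pi.single i 1) + F (x - Pi.single i 1) ≤ nbSum F x :=
  Finset.single_le_sum (f := fun i => F (x + Pi.single i 1) + F (x - Pi.single i 1))
    (fun _ _ => add_nonneg (hF _) (hF _)) (Finset.mem_univ i)

lemma subPot_le_nbSum {d : ℕ} (hd : d = 3 ∨ d = 4) {x : Zd d} (hx0 : x ≠ 0) :
    2 * d * subPot d x ≤ nbSum (subPot d) x := by
  by_cases hr25 : 25 ≤ sqn x
  · exact subPot_le_nbSum_of_le hd hr25
  have hnn : ∀ y, 0 ≤ subPot d y := fun y => (subPot_pos hd y).le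
  obtain ⟨i, hi⟩ := Function.ne_iff.1 hx0
  have hle := add_le_nbSum hnn x i
  have hi' : x i ≤ -1 ∨ 1 ≤ x i := by
    have : x i ≠ 0 := hi
    omega
  rcases hi' with hneg | hpos
  · have h1 : (x i : ℝ) ≤ -1 := by exact_mod_cast hneg
    have h2 := mul_subPot_le hd (y := x + Pi.single i 1) hr25 (by rw [sqn_add_one]; linarith)
    linarith [hnn (x - Pi.single i 1)]
  · have h1 : (1 : ℝ) ≤ (x i : ℝ) := by exact_mod_cast hpos
    have h2 := mul_subPot_le hd (y := x - Pi.single i 1) hr25 (by rw [sqn_sub_one]; linarith)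
    linarith [hnn (x + Pi.single i 1)]

lemma exists_subPot_le {d : ℕ} (hd : d = 3 ∨ d = 4) :
    ∃ C : ℝ, 0 < C ∧ ∀ x, subPot d x ≤ C * superPot d x := by
  have hdd : (3 : ℝ) ≤ d := by rcases hd with rfl | rfl <;> norm_num
  have p1 := radial_pos d (t := 1 / 5) (by norm_num)
  have p2 := radial_pos d (t := 89) (by norm_num)
  have p3 : 0 < (2 * d : ℝ) ^ (25 : ℝ) := Real.rpow_pos_of_pos (by linarith) _
  refine ⟨radial d (1 / 5) + (2 * d : ℝ) ^ (25 : ℝ) / radial d 89, by positivity, fun x => ?_⟩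
  have hr0 := sqn_nonneg x
  have hu := superPot_pos x
  rw [add_mul, subPot]
  split_ifs with h
  · have : radial d (sqn x - 5) ≤ radial d (1 / 5) * superPot d x := by
      rw [superPot, ← radial_mul d (by norm_num) (by linarith)]
      exact radial_anti hd (by linarith) (by linarith)
    have := mul_pos (div_pos p3 p2) hu
    linarith
  · have h1 : (2 * d : ℝ) ^ (25 - sqn x) ≤ (2 * d : ℝ) ^ (25 : ℝ) :=
      Real.rpow_le_rpow_of_exponent_le (by linarith) (by linarith)
    have h2 : radial d 89 ≤ superPot d x := radial_anti hd (by linarith) (by linarith)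
    have h3 : (2 * d : ℝ) ^ (25 : ℝ) ≤ (2 * d : ℝ) ^ (25 : ℝ) / radial d 89 * superPot d x := by
      rw [div_mul_eq_mul_div, le_div_iff₀ p2]
      exact mul_le_mul_of_nonneg_left h2 p3.le
    have := mul_pos p1 hu
    linarith

lemma add_single_ne {d : ℕ} (y : Zd d) (i : Fin d) : y + Pi.single i 1 ≠ y := by
  intro h
  simpa using congrFun h i

lemma sub_single_ne {d : ℕ} (y : Zd d) (i : Fin d) : y - Pi.single i 1 ≠ y := by
  intro h
  simpa using congrFun h i

lemma znorm_eq_one_iff {d : ℕ} (v : Zd d) :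
    znorm v = 1 ↔ ∃ i, v = Pi.single i 1 ∨ v = -Pi.single i 1 := by
  have h1 : znorm v = 1 ↔ ∑ i, (v i) ^ 2 = 1 := by
    rw [znorm, Real.sqrt_eq_one]
    exact_mod_cast Iff.rfl
  rw [h1]
  constructor
  · intro h
    have hv : v ≠ 0 := by
      rintro rfl
      simp at h
    obtain ⟨i, hi⟩ := Function.ne_iff.1 hv
    have hi0 : v i ≠ 0 := hi
    rw [← Finset.add_sum_erase _ _ (Finset.mem_univ i)] at h
    have h2 : 0 ≤ ∑ j ∈ Finset.univ.erase i, (v j) ^ 2 := Finset.sum_nonneg fun _ _ => sq_nonneg _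
    have h3 : 0 < (v i) ^ 2 := by positivity
    have h4 : (v i) ^ 2 = 1 := by linarith
    have h5 : ∑ j ∈ Finset.univ.erase i, (v j) ^ 2 = 0 := by linarith
    rw [Finset.sum_eq_zero_iff_of_nonneg fun _ _ => sq_nonneg _] at h5
    have h6 : ∀ j, j ≠ i → v j = 0 := fun j hj => by
      simpa using h5 j (Finset.mem_erase.2 ⟨hj, Finset.mem_univ j⟩)
    refine ⟨i, ?_⟩
    rcases mul_self_eq_one_iff.1 ((sq _).symm.trans h4) with h | h
    · left
      ext j
      by_cases hj : j = i
      · subst hj; simp [h]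
      · simp [hj, h6 j hj]
    · right
      ext j
      by_cases hj : j = i
      · subst hj; simp [h]
      · simp [hj, h6 j hj]
  · rintro ⟨i, rfl | rfl⟩ <;> simp [Pi.single_apply, ite_pow]

lemma tsum_mul_trapK {d : ℕ} (ρ : Zd d → ℝ) (F : Zd d → ℝ≥0∞) (y : Zd d) :
    ∑' z, F z * trapK ρ z y = F y * ENNReal.ofReal (ρ y)
      + ∑ i, (F (y + Pi.single i 1) * ENNReal.ofReal ((1 - ρ (y + Pi.single i 1)) / (2 * d))
        + F (y - Pi.single i 1) * ENNReal.ofReal ((1 - ρ (y - Pi.single i 1)) / (2 * d))) := by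
  set s₁ : Finset (Zd d) := Finset.univ.image fun i => y + Pi.single i 1 with hs₁
  set s₂ : Finset (Zd d) := Finset.univ.image fun i => y - Pi.single i 1 with hs₂
  have hinj : Function.Injective fun i : Fin d => (Pi.single i 1 : Zd d) := fun i j h => by
    by_contra hne
    simpa [Pi.single_apply, hne] using congrFun h i
  have hdisj : Disjoint s₁ s₂ := by
    rw [Finset.disjoint_left]
    intro z h1 h2
    obtain ⟨i, -, rfl⟩ := Finset.mem_image.1 h1
    obtain ⟨j, -, h⟩ := Finset.mem_image.1 h2
    have := congrFun h i
    simp only [Pi.sub_apply, Pi.add_apply, Pi.single_apply] at this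
    split_ifs at this <;> omega
  have hy : y ∉ s₁ ∪ s₂ := by
    simp [hs₁, hs₂]
  rw [tsum_eq_sum (s := insert y (s₁ ∪ s₂)), Finset.sum_insert hy, Finset.sum_union hdisj,
    Finset.sum_image fun i _ j _ h => hinj (add_left_cancel h),
    Finset.sum_image fun i _ j _ h => hinj (sub_right_injective h), ← Finset.sum_add_distrib]
  · congr 1
    · simp [trapK]
    · refine Finset.sum_congr rfl fun i _ => ?_
      have n1 : znorm (y + Pi.single i 1 - y) = 1 :=
        (znorm_eq_one_iff _).2 ⟨i, Or.inl (add_sub_cancel_left _ _)⟩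
      have n2 : znorm (y - Pi.single i 1 - y) = 1 :=
        (znorm_eq_one_iff _).2 ⟨i, Or.inr (by abel)⟩
      rw [trapK, trapK, if_neg (add_single_ne y i), if_neg (sub_single_ne y i), if_pos n1,
        if_pos n2]
  · intro z hz
    rw [Finset.mem_insert, not_or, Finset.mem_union, not_or] at hz
    rw [trapK, if_neg hz.1, if_neg, mul_zero]
    intro h
    obtain ⟨i, h | h⟩ := (znorm_eq_one_iff _).1 h
    · exact hz.2.1 (Finset.mem_image.2 ⟨i, Finset.mem_univ i, by rw [← h]; abel⟩)
    · exact hz.2.2 (Finset.mem_image.2 ⟨i, Finset.mem_univ i, by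
        rw [sub_eq_add_neg, ← h]; abel⟩)

lemma tsum_kpow_eq {d : ℕ} (p : Zd d → Zd d → ℝ≥0∞) (x y : Zd d) :
    ∑' k, kpow p k x y = (if x = y then 1 else 0) + ∑' z, (∑' k, kpow p k x z) * p z y := by
  rw [tsum_eq_zero_add' ENNReal.summable]
  congr 1
  simp only [kpow, ← ENNReal.tsum_mul_right]
  exact ENNReal.tsum_comm

lemma tsum_kpow_le {d : ℕ} (p : Zd d → Zd d → ℝ≥0∞) (x : Zd d) (V : Zd d → ℝ≥0∞)
    (hV : ∀ y, (if x = y then 1 else 0) + ∑' z, V z * p z y ≤ V y) (y : Zd d) :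
    ∑' k, kpow p k x y ≤ V y := by
  refine ENNReal.tsum_le_of_sum_range_le fun N => ?_
  induction N generalizing y with
  | zero => simp
  | succ N ih =>
    refine le_trans ?_ (hV y)
    rw [Finset.sum_range_succ', add_comm]
    gcongr
    · exact le_rfl
    · simp only [kpow]
      rw [← Summable.tsum_finsetSum fun _ _ => ENNReal.summable]
      refine ENNReal.tsum_le_tsum fun z => ?_
      rw [← Finset.sum_mul]
      gcongr
      exact ih z

lemma tsum_kpow_kill_ne_top {d : ℕ} (hd : d = 3 ∨ d = 4) {ρ : Zd d → ℝ}
    (hρ : ∀ x, ρ x ∈ Set.Ico (0 : ℝ) 1) (B : Set (Zd d)) (y : Zd d) :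
    ∑' k, kpow (kill (trapK ρ) B) k 0 y ≠ ∞ := by
  have hdd : (3 : ℝ) ≤ d := by rcases hd with rfl | rfl <;> norm_num
  have hgap := sub_pos.2 (nbSum_superPot_zero_lt hd)
  set C : ℝ := 2 * d / (2 * d * superPot d 0 - nbSum (superPot d) 0) with hC
  have hC0 : 0 < C := div_pos (by linarith) hgap
  have hu : ∀ x : Zd d, 0 < superPot d x := superPot_pos
  have hsuper : ∀ y : Zd d, (if (0 : Zd d) = y then 1 else 0)
      + C / (2 * d) * nbSum (superPot d) y ≤ C * superPot d y := fun y => by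
    split_ifs with h
    · subst h
      have : C * (2 * d * superPot d 0 - nbSum (superPot d) 0) = 2 * d :=
        div_mul_cancel₀ _ hgap.ne'
      have h2 : C / (2 * d) * (2 * d * superPot d 0 - nbSum (superPot d) 0) = 1 := by
        rw [div_mul_eq_mul_div, this, div_self (by positivity)]
      have h3 : C / (2 * d) * (2 * d * superPot d 0) = C * superPot d 0 := by field_simp
      linarith
    · have h2 := mul_le_mul_of_nonneg_left (nbSum_superPot_le hd y)
        (by positivity : 0 ≤ C / (2 * d))
      have h3 : C / (2 * d) * (2 * d * superPot d y) = C * superPot d y := by field_simp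
      linarith
  refine ne_top_of_le_ne_top ENNReal.ofReal_ne_top (tsum_kpow_le _ _
    (fun y => ENNReal.ofReal (C * superPot d y / (1 - ρ y))) (fun y => ?_) y)
  have h1 : ∀ z, 0 < 1 - ρ z := fun z => sub_pos.2 (hρ z).2
  have hstep : ∀ z, ENNReal.ofReal (C * superPot d z / (1 - ρ z))
      * ENNReal.ofReal ((1 - ρ z) / (2 * d)) = ENNReal.ofReal (C / (2 * d) * superPot d z) :=
    fun z => by
      have := h1 z
      rw [← ENNReal.ofReal_mul (by have := hu z; positivity)]
      congr 1
      field_simp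
  calc _ ≤ (if (0 : Zd d) = y then 1 else 0)
        + ∑' z, ENNReal.ofReal (C * superPot d z / (1 - ρ z)) * trapK ρ z y := by
        gcongr with z
        rw [kill]
        split_ifs <;> simp
    _ = ENNReal.ofReal (if (0 : Zd d) = y then 1 else 0)
        + (ENNReal.ofReal (C * superPot d y / (1 - ρ y) * ρ y)
        + ENNReal.ofReal (C / (2 * d) * nbSum (superPot d) y)) := by
        rw [tsum_mul_trapK]
        congr 1
        · split_ifs <;> simp
        congr 1
        · rw [ENNReal.ofReal_mul (div_nonneg (mul_pos hC0 (hu y)).le (h1 y).le)]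
        · simp only [hstep]
          rw [← nbSum_const_mul, nbSum, ENNReal.ofReal_sum_of_nonneg]
          · refine Finset.sum_congr rfl fun i _ => ?_
            rw [ENNReal.ofReal_add] <;> exact (mul_pos (by positivity) (hu _)).le
          · intro i _
            exact add_nonneg (mul_pos (by positivity) (hu _)).le
              (mul_pos (by positivity) (hu _)).le
    _ ≤ _ := by
        have hn : 0 ≤ C / (2 * d) * nbSum (superPot d) y :=
          mul_nonneg (by positivity)
            (Finset.sum_nonneg fun i _ => add_nonneg (hu _).le (hu _).le)
        have hm : 0 ≤ C * superPot d y / (1 - ρ y) * ρ y :=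
          mul_nonneg (div_nonneg (mul_pos hC0 (hu y)).le (h1 y).le) (hρ y).1
        rw [← ENNReal.ofReal_add hm hn, ← ENNReal.ofReal_add (by split_ifs <;> norm_num)
          (by positivity)]
        apply ENNReal.ofReal_le_ofReal
        have e : C * superPot d y / (1 - ρ y) - C * superPot d y / (1 - ρ y) * ρ y
            = C * superPot d y := by
          have := (h1 y).ne'
          field_simp
        linarith [hsuper y]

lemma exists_real_green {d : ℕ} (hd : d = 3 ∨ d = 4) {ρ : Zd d → ℝ}
    (hρ : ∀ x, ρ x ∈ Set.Ico (0 : ℝ) 1) (B : Set (Zd d)) :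
    ∃ f : Zd d → ℝ, (∀ y, 0 ≤ f y) ∧
      (∀ y, ENNReal.ofReal (f y) ≤ ∑' k, kpow (kill (trapK ρ) B) k 0 y / piT ρ y) ∧
      ∀ y ∈ B, 2 * d * f y = (if (0 : Zd d) = y then (2 * d : ℝ) else 0) + nbSum f y := by
  have hdd : (3 : ℝ) ≤ d := by rcases hd with rfl | rfl <;> norm_num
  set H : Zd d → ℝ≥0∞ := fun y => ∑' k, kpow (kill (trapK ρ) B) k 0 y with hH
  have hfin : ∀ y, H y ≠ ∞ := tsum_kpow_kill_ne_top hd hρ B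
  have h1 : ∀ z, 0 < 1 - ρ z := fun z => sub_pos.2 (hρ z).2
  set f : Zd d → ℝ := fun y => if y ∈ B then (H y).toReal * (1 - ρ y) else 0 with hf
  have hf0 : ∀ y, 0 ≤ f y := fun y => by
    simp only [hf]
    split_ifs
    · exact mul_nonneg ENNReal.toReal_nonneg (h1 y).le
    · exact le_rfl
  refine ⟨f, hf0, fun y => ?_, fun y hy => ?_⟩
  · simp only [hf]
    split_ifs with hy
    · simp only [div_eq_mul_inv]
      rw [ENNReal.tsum_mul_right, ENNReal.ofReal_mul ENNReal.toReal_nonneg,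
        ENNReal.ofReal_toReal (hfin y), piT, ← ENNReal.ofReal_inv_of_pos (inv_pos.2 (h1 y)),
        inv_inv]
    · simp
  · have hstep : ∀ z, (if z ∈ B then H z else 0) * ENNReal.ofReal ((1 - ρ z) / (2 * d))
        = ENNReal.ofReal (f z / (2 * d)) := fun z => by
      simp only [hf]
      split_ifs with hz
      · rw [mul_div_assoc, ENNReal.ofReal_mul ENNReal.toReal_nonneg,
          ENNReal.ofReal_toReal (hfin z)]
      · simp
    have hn : 0 ≤ nbSum f y / (2 * d) :=
      div_nonneg (Finset.sum_nonneg fun i _ => add_nonneg (hf0 _) (hf0 _)) (by positivity)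
    have hm : 0 ≤ (H y).toReal * ρ y := mul_nonneg ENNReal.toReal_nonneg (hρ y).1
    have key : ENNReal.ofReal (H y).toReal = ENNReal.ofReal
        ((if (0 : Zd d) = y then 1 else 0) + ((H y).toReal * ρ y + nbSum f y / (2 * d))) := by
      rw [ENNReal.ofReal_toReal (hfin y), ENNReal.ofReal_add (by split_ifs <;> norm_num)
        (by positivity), ENNReal.ofReal_add hm hn, ENNReal.ofReal_mul ENNReal.toReal_nonneg,
        ENNReal.ofReal_toReal (hfin y)]
      have e : ∀ z, H z * kill (trapK ρ) B z y = (if z ∈ B then H z else 0) * trapK ρ z y :=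
        fun z => by
          rw [kill]
          by_cases hz : z ∈ B <;> simp [hz, hy]
      calc H y = _ := tsum_kpow_eq _ _ _
        _ = _ := by
          rw [tsum_congr e, tsum_mul_trapK, if_pos hy]
          congr 1
          · split_ifs <;> simp
          congr 1
          simp only [hstep, nbSum, Finset.sum_div]
          rw [ENNReal.ofReal_sum_of_nonneg]
          · refine Finset.sum_congr rfl fun i _ => ?_
            rw [add_div, ENNReal.ofReal_add] <;> exact div_nonneg (hf0 _) (by positivity)
          · intro i _
            exact div_nonneg (add_nonneg (hf0 _) (hf0 _)) (by positivity)
    rw [ENNReal.ofReal_eq_ofReal_iff ENNReal.toReal_nonneg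
      (add_nonneg (by split_ifs <;> norm_num) (add_nonneg hm hn))] at key
    have hfy : f y = (H y).toReal * (1 - ρ y) := if_pos hy
    have h2 : f y = (if (0 : Zd d) = y then 1 else 0) + nbSum f y / (2 * d) := by
      rw [hfy]
      linarith
    rw [h2]
    split_ifs
    · field_simp
    · field_simp
      ring

lemma nonpos_of_le_nbSum {d : ℕ} (i : Fin d) (B : Finset (Zd d)) (D : Zd d → ℝ)
    (hoff : ∀ y, y ∉ B → D y ≤ 0) (hB : ∀ y ∈ B, 2 * d * D y ≤ nbSum D y) (y : Zd d) :
    D y ≤ 0 := by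
  by_contra! hy
  have hyB : y ∈ B := by
    by_contra h
    exact absurd (hoff y h) (not_le.2 hy)
  obtain ⟨y₁, hy₁, hmax⟩ := Finset.exists_max_image B D ⟨y, hyB⟩
  have hpos : 0 < D y₁ := hy.trans_le (hmax y hyB)
  have hle : ∀ z, D z ≤ D y₁ := fun z => by
    by_cases hz : z ∈ B
    · exact hmax z hz
    · exact (hoff z hz).trans hpos.le
  obtain ⟨y₂, hy₂, htop⟩ := Finset.exists_max_image (B.filter fun z => D z = D y₁)
    (fun z => z i) ⟨y₁, Finset.mem_filter.2 ⟨hy₁, rfl⟩⟩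
  obtain ⟨hy₂B, hy₂D⟩ := Finset.mem_filter.1 hy₂
  have hnb : D (y₂ + Pi.single i 1) = D y₁ := by
    by_contra hne
    have hlt := lt_of_le_of_ne (hle _) hne
    have : nbSum D y₂ < nbSum (fun _ => D y₁) y₂ :=
      Finset.sum_lt_sum (fun j _ => add_le_add (hle _) (hle _))
        ⟨i, Finset.mem_univ i, add_lt_add_of_lt_of_le hlt (hle _)⟩
    rw [nbSum_const, ← hy₂D] at this
    exact absurd (hB y₂ hy₂B) (not_le.2 this)
  have hmem : y₂ + Pi.single i 1 ∈ B := by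
    by_contra h
    exact absurd (hoff _ h) (not_le.2 (hnb ▸ hpos))
  have := htop _ (Finset.mem_filter.2 ⟨hmem, hnb⟩)
  simp at this

lemma exists_gKillTrap_lower {d : ℕ} (hd : d = 3 ∨ d = 4) :
    ∃ c C : ℝ, 0 < c ∧ 0 < C ∧ ∀ (ρ : Zd d → ℝ), (∀ x, ρ x ∈ Set.Ico (0 : ℝ) 1) →
      ∀ (R : ℝ) (m : ℕ) (b : ℝ), 0 ≤ b → (∀ y, y ∉ lamF d m → subPot d y ≤ b) → ∀ x,
        ENNReal.ofReal (c * (subPot d x - b)) ≤ gKillTrap ρ R m 0 x + ENNReal.ofReal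
          (C * ∑ a ∈ (lamF d m).filter (· ∈ Atrap R ρ), superPot d a * superPot d (x - a)) := by
  have hdd : (3 : ℝ) ≤ d := by rcases hd with rfl | rfl <;> norm_num
  obtain ⟨C₁, hC₁, hC₁le⟩ := exists_subPot_le hd
  have hw0 := subPot_pos hd (0 : Zd d)
  have hu : ∀ x : Zd d, 0 < superPot d x := superPot_pos
  set c : ℝ := (subPot d 0)⁻¹ with hc
  have hc0 : 0 < c := inv_pos.2 hw0
  set C : ℝ := c * C₁ / superPot d 0 with hC
  have hC0 : 0 < C := div_pos (mul_pos hc0 hC₁) (hu 0)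
  refine ⟨c, C, hc0, hC0, fun ρ hρ R m b hb hbd x => ?_⟩
  set T := (lamF d m).filter (· ∈ Atrap R ρ) with hT
  set S : Zd d → ℝ := fun y => ∑ a ∈ T, superPot d a * superPot d (y - a) with hS
  have hS0 : ∀ y, 0 ≤ S y := fun y => Finset.sum_nonneg fun a _ => (mul_pos (hu _) (hu _)).le
  set B := (lamF d m).filter (· ∉ Atrap R ρ) with hB
  have hBset : ((lamF d m : Set (Zd d)) \ Atrap R ρ) = (B : Set (Zd d)) := by
    ext y
    simp [hB]
  obtain ⟨f, hf0, hfle, hfeq⟩ := exists_real_green hd hρ ((lamF d m : Set (Zd d)) \ Atrap R ρ)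
  have hmax : ∀ y, c * (subPot d y - b) - C * S y - f y ≤ 0 := by
    refine nonpos_of_le_nbSum ⟨0, by omega⟩ B _ (fun y hy => ?_) (fun y hy => ?_)
    · by_cases hyΛ : y ∈ lamF d m
      · have hyT : y ∈ T := by
          simp only [hB, Finset.mem_filter, not_and, not_not] at hy
          exact Finset.mem_filter.2 ⟨hyΛ, hy hyΛ⟩
        have h1 : superPot d y * superPot d 0 ≤ S y := by
          have := Finset.single_le_sum (f := fun a => superPot d a * superPot d (y - a))
            (fun a _ => (mul_pos (hu _) (hu _)).le) hyT
          simpa using this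
        have h2 := mul_le_mul_of_nonneg_left h1 hC0.le
        have h3 : C * (superPot d y * superPot d 0) = c * (C₁ * superPot d y) := by
          rw [hC]
          have := (hu 0).ne'
          field_simp
        have h4 := mul_le_mul_of_nonneg_left (hC₁le y) hc0.le
        have h5 := mul_nonneg hc0.le hb
        linarith [hf0 y]
      · have h1 := mul_le_mul_of_nonneg_left (hbd y hyΛ) hc0.le
        have h2 := mul_nonneg hC0.le (hS0 y)
        linarith [hf0 y]
    · have hyf := hfeq y (hBset ▸ hy)
      have e : nbSum (fun z => c * (subPot d z - b) - C * S z - f z) y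
          = c * (nbSum (subPot d) y - 2 * d * b) - C * nbSum S y - nbSum f y := by
        rw [nbSum_sub, nbSum_sub, nbSum_const_mul, nbSum_const_mul, nbSum_sub, nbSum_const]
      have hSsup : nbSum S y ≤ 2 * d * S y := by
        simp only [hS]
        rw [nbSum_sum, Finset.mul_sum]
        refine Finset.sum_le_sum fun a _ => ?_
        rw [nbSum_const_mul, nbSum_comp_sub]
        have := mul_le_mul_of_nonneg_left (nbSum_superPot_le hd (y - a)) (hu a).le
        linarith
      have h1 := mul_le_mul_of_nonneg_left hSsup hC0.le
      have h2 : c * (2 * d * subPot d y)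
          ≤ (if (0 : Zd d) = y then (2 * d : ℝ) else 0) + c * nbSum (subPot d) y := by
        split_ifs with h
        · subst h
          have h3 : c * (2 * d * subPot d 0) = 2 * d := by
            rw [hc]
            field_simp
          have h4 : 0 ≤ nbSum (subPot d) (0 : Zd d) :=
            Finset.sum_nonneg fun i _ => add_nonneg (subPot_pos hd _).le (subPot_pos hd _).le
          have h5 := mul_nonneg hc0.le h4
          linarith
        · have := mul_le_mul_of_nonneg_left (subPot_le_nbSum hd (Ne.symm h)) hc0.le
          linarith
      rw [e]
      linarith
  have h1 : c * (subPot d x - b) ≤ f x + C * S x := by linarith [hmax x]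
  calc _ ≤ ENNReal.ofReal (f x + C * S x) := ENNReal.ofReal_le_ofReal h1
    _ = ENNReal.ofReal (f x) + ENNReal.ofReal (C * S x) :=
        ENNReal.ofReal_add (hf0 x) (mul_nonneg hC0.le (hS0 x))
    _ ≤ _ := by
        gcongr
        exact hfle x

lemma sum_Icc_rpow_le {γ : ℝ} (h0 : 0 < γ) (h1 : γ ≤ 1) (r : ℕ) :
    ∑ k ∈ Finset.Icc (-(r : ℤ)) r, ((k : ℝ) ^ 2 + 1) ^ (-((1 - γ) / 2))
      ≤ 1 + 2 / γ * (r : ℝ) ^ γ := by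
  induction r with
  | zero => simp [Real.zero_rpow h0.ne']
  | succ r ih =>
    have e : Finset.Icc (-((r + 1 : ℕ) : ℤ)) ((r + 1 : ℕ) : ℤ)
        = insert (-((r : ℤ) + 1)) (insert ((r : ℤ) + 1) (Finset.Icc (-(r : ℤ)) r)) := by
      ext k
      simp only [Finset.mem_Icc, Finset.mem_insert]
      push_cast
      omega
    rw [e, Finset.sum_insert (by simp only [Finset.mem_Icc, Finset.mem_insert]; omega),
      Finset.sum_insert (by simp only [Finset.mem_Icc]; omega)]
    have hr : (0 : ℝ) < (r : ℝ) + 1 := by positivity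
    have h2 : (((r : ℝ) + 1) ^ 2 + 1) ^ (-((1 - γ) / 2)) ≤ ((r : ℝ) + 1) ^ (γ - 1) := by
      calc _ ≤ (((r : ℝ) + 1) ^ 2) ^ (-((1 - γ) / 2)) :=
            Real.rpow_le_rpow_of_nonpos (by positivity) (by linarith) (by linarith)
        _ = _ := by
            rw [← Real.rpow_natCast, ← Real.rpow_mul hr.le]
            congr 1
            push_cast
            ring
    have h3 : ((r : ℝ) + 1) ^ (γ - 1) ≤ 1 / γ * (((r : ℝ) + 1) ^ γ - (r : ℝ) ^ γ) := by
      have hb : (1 + -(1 / ((r : ℝ) + 1))) ^ γ ≤ 1 + γ * -(1 / ((r : ℝ) + 1)) :=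
        rpow_one_add_le_one_add_mul_self
          (neg_le_neg ((div_le_one hr).2 (by linarith [Nat.cast_nonneg (α := ℝ) r]))) h0.le h1
      have h4 : (r : ℝ) ^ γ = ((r : ℝ) + 1) ^ γ * (1 + -(1 / ((r : ℝ) + 1))) ^ γ := by
        rw [← Real.mul_rpow hr.le]
        · congr 1
          field_simp
          ring
        · have : 1 / ((r : ℝ) + 1) ≤ 1 :=
            (div_le_one hr).2 (by linarith [Nat.cast_nonneg (α := ℝ) r])
          linarith
      have h5 := mul_le_mul_of_nonneg_left hb (Real.rpow_pos_of_pos hr γ).le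
      rw [← h4] at h5
      rw [Real.rpow_sub_one hr.ne', one_div_mul_eq_div, le_div_iff₀ h0]
      have h6 : ((r : ℝ) + 1) ^ γ * (1 + γ * -(1 / ((r : ℝ) + 1)))
          = ((r : ℝ) + 1) ^ γ - ((r : ℝ) + 1) ^ γ / ((r : ℝ) + 1) * γ := by
        field_simp
        ring
      linarith
    have h7 : 2 / γ * (((r + 1 : ℕ) : ℝ)) ^ γ
        = 2 / γ * (r : ℝ) ^ γ + 2 * (1 / γ * (((r : ℝ) + 1) ^ γ - (r : ℝ) ^ γ)) := by
      push_cast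
      ring
    rw [h7]
    push_cast
    rw [neg_sq]
    linarith

lemma exists_sum_superPot_le {d : ℕ} (hd : d = 3 ∨ d = 4) :
    ∃ C : ℝ, 0 < C ∧ ∀ r : ℕ, 1 ≤ r → ∑ a ∈ lamF d r, superPot d a ≤ C * (r : ℝ) ^ 2 := by
  have hdd : (3 : ℝ) ≤ d := by rcases hd with rfl | rfl <;> norm_num
  set γ : ℝ := 2 / d with hγ
  have h0 : 0 < γ := by positivity
  have h1 : γ ≤ 1 := (div_le_one (by linarith)).2 (by linarith)
  refine ⟨(1 + 2 / γ) ^ d, by positivity, fun r hr => ?_⟩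
  have hr1 : (1 : ℝ) ≤ r := by exact_mod_cast hr
  calc ∑ a ∈ lamF d r, superPot d a
      ≤ ∑ a ∈ lamF d r, ∏ i, (((a i : ℝ)) ^ 2 + 1) ^ (-((1 - γ) / 2)) := by
        refine Finset.sum_le_sum fun a _ => ?_
        have hs : 0 < sqn a + 64 := by linarith [sqn_nonneg a]
        have e : superPot d a = ∏ _i : Fin d, (sqn a + 64) ^ (-((1 - γ) / 2)) := by
          rw [Finset.prod_const, Finset.card_univ, Fintype.card_fin, ← Real.rpow_natCast,
            ← Real.rpow_mul hs.le, superPot, radial]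
          congr 1
          rw [hγ]
          field_simp
        rw [e]
        refine Finset.prod_le_prod (fun i _ => (Real.rpow_pos_of_pos hs _).le) fun i _ => ?_
        exact Real.rpow_le_rpow_of_nonpos (by positivity) (by linarith [sq_le_sqn a i])
          (by linarith)
    _ = ∏ _i : Fin d, ∑ k ∈ Finset.Icc (-(r : ℤ)) r, ((k : ℝ) ^ 2 + 1) ^ (-((1 - γ) / 2)) := by
        rw [Finset.prod_univ_sum, lamF]
    _ ≤ ∏ _i : Fin d, ((1 + 2 / γ) * (r : ℝ) ^ γ) := by
        refine Finset.prod_le_prod (fun i _ => Finset.sum_nonneg fun k _ => by positivity)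
          fun i _ => (sum_Icc_rpow_le h0 h1 r).trans ?_
        have := Real.one_le_rpow hr1 h0.le
        linarith
    _ = _ := by
        rw [Finset.prod_const, Finset.card_univ, Fintype.card_fin, mul_pow,
          ← Real.rpow_mul_natCast (by linarith), hγ, div_mul_cancel₀ _ (by positivity),
          Real.rpow_two]

lemma abs_coord_le_znorm {d : ℕ} (x : Zd d) (i : Fin d) : |(x i : ℝ)| ≤ znorm x :=
  Real.abs_le_sqrt (sq_le_sqn x i)

lemma mem_lamF_floor {d : ℕ} {a : Zd d} {s : ℝ} (h : znorm a ≤ s) : a ∈ lamF d ⌊s⌋₊ := by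
  rw [lamF, Fintype.mem_piFinset]
  intro i
  have h1 : ((a i).natAbs : ℝ) ≤ s := by
    rw [Nat.cast_natAbs, Int.cast_abs]
    exact (abs_coord_le_znorm a i).trans h
  have h2 : (a i).natAbs ≤ ⌊s⌋₊ := Nat.le_floor h1
  rw [Finset.mem_Icc]
  omega

lemma exists_sum_ball_superPot_le {d : ℕ} (hd : d = 3 ∨ d = 4) :
    ∃ C : ℝ, 0 < C ∧ ∀ (m : ℕ) (x : Zd d) (q : ℝ), 0 ≤ q →
      ∑ a ∈ (lamF d m).filter (fun a => max (znorm a) 1 ^ 2 ≤ q),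
        (superPot d a + superPot d (x - a)) ≤ C * q := by
  obtain ⟨C, hC, hsum⟩ := exists_sum_superPot_le hd
  have hu : ∀ x : Zd d, 0 < superPot d x := superPot_pos
  refine ⟨3 * C, by positivity, fun m x q hq => ?_⟩
  by_cases hq1 : 1 ≤ q
  · set r := ⌊√q⌋₊ with hr
    have hr1 : 1 ≤ r := Nat.le_floor (by simpa using Real.one_le_sqrt.2 hq1)
    have hrq : (r : ℝ) ^ 2 ≤ q := by
      calc (r : ℝ) ^ 2 ≤ (√q) ^ 2 := by
            gcongr
            exact Nat.floor_le (Real.sqrt_nonneg _)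
        _ = q := Real.sq_sqrt hq
    have hsub : ∀ {a : Zd d}, sqn a ≤ q → a ∈ lamF d r := fun {a} ha =>
      mem_lamF_floor (Real.sqrt_le_sqrt ha)
    have hfilter : ∀ a ∈ (lamF d m).filter (fun a => max (znorm a) 1 ^ 2 ≤ q), sqn a ≤ q := by
      intro a ha
      refine le_trans ?_ (Finset.mem_filter.1 ha).2
      rw [← znorm_sq]
      have := znorm_nonneg a
      gcongr
      exact le_max_left _ _
    calc _ ≤ ∑ a ∈ (lamF d m).filter (fun a => max (znorm a) 1 ^ 2 ≤ q),
          (2 * superPot d a + if x - a ∈ lamF d r then superPot d (x - a) else 0) := by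
          refine Finset.sum_le_sum fun a ha => ?_
          have haq := hfilter a ha
          by_cases hle : sqn (x - a) ≤ sqn a
          · rw [if_pos (hsub (hle.trans haq))]
            linarith [hu a]
          · have : superPot d (x - a) ≤ superPot d a :=
              radial_anti hd (by linarith [sqn_nonneg a]) (by linarith)
            have h2 : 0 ≤ if x - a ∈ lamF d r then superPot d (x - a) else 0 := by
              split_ifs
              · exact (hu _).le
              · exact le_rfl
            linarith
      _ ≤ ∑ a ∈ lamF d r,
          (2 * superPot d a + if x - a ∈ lamF d r then superPot d (x - a) else 0) := by
          refine Finset.sum_le_sum_of_subset_of_nonneg (fun a ha => hsub (hfilter a ha))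
            fun a _ _ => ?_
          have := hu a
          have := hu (x - a)
          split_ifs <;> positivity
      _ ≤ 2 * ∑ a ∈ lamF d r, superPot d a + ∑ a ∈ lamF d r, superPot d a := by
          rw [Finset.sum_add_distrib, ← Finset.mul_sum, ← Finset.sum_filter]
          gcongr
          rw [← Finset.sum_image (f := superPot d) (g := fun a => x - a)
            fun a _ b _ h => sub_right_injective h]
          refine Finset.sum_le_sum_of_subset_of_nonneg (fun b hb => ?_) fun b _ _ => (hu b).le
          obtain ⟨a, ha, rfl⟩ := Finset.mem_image.1 hb
          exact (Finset.mem_filter.1 ha).2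
      _ ≤ 3 * C * q := by
          have h1 := hsum r hr1
          have h2 := mul_le_mul_of_nonneg_left hrq hC.le
          linarith
  · rw [Finset.filter_false_of_mem, Finset.sum_empty]
    · positivity
    · intro a _ h
      refine hq1 (le_trans ?_ h)
      exact one_le_pow₀ (le_max_right _ _)

lemma superPot_mul_le {d : ℕ} (hd : d = 3 ∨ d = 4) {x : Zd d} (hx : x ≠ 0) (a : Zd d) :
    superPot d a * superPot d (x - a)
      ≤ radial d (1 / 4) * radial d (sqn x) * (superPot d a + superPot d (x - a)) := by
  have hs := one_le_sqn hx
  have hu : ∀ x : Zd d, 0 < superPot d x := superPot_pos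
  have hk : 0 < radial d (1 / 4) * radial d (sqn x) :=
    mul_pos (radial_pos d (by norm_num)) (radial_pos d (by linarith))
  have key : ∀ z : Zd d, sqn x / 4 ≤ sqn z →
      superPot d z ≤ radial d (1 / 4) * radial d (sqn x) := fun z hz => by
    rw [← radial_mul d (by norm_num) (by linarith)]
    exact radial_anti hd (by linarith) (by linarith)
  have hsum := sqn_add_le a (x - a)
  rw [add_sub_cancel] at hsum
  rcases le_total (sqn (x - a)) (sqn a) with h | h
  · have h1 := mul_le_mul_of_nonneg_right (key a (by linarith)) (hu (x - a)).le
    have h2 := mul_pos hk (hu a)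
    linarith
  · have h1 := mul_le_mul_of_nonneg_left (key (x - a) (by linarith)) (hu a).le
    have h2 := mul_pos hk (hu (x - a))
    linarith

lemma measurableSet_deep {d : ℕ} (a : Zd d) (s : ℝ) :
    MeasurableSet {ρ : Zd d → ℝ | s ≤ (1 - ρ a)⁻¹} :=
  measurableSet_le measurable_const (measurable_const.sub (measurable_pi_apply a)).inv

lemma measure_mem_Atrap {d : ℕ} {P : Measure (Zd d → ℝ)}
    (hstat : ∀ z : Zd d, P.map (fun ρ x => ρ (x + z)) = P) (R : ℝ) (a : Zd d) :
    P {ρ | a ∈ Atrap R ρ} = P {ρ | R * max (znorm a) 1 ^ 2 ≤ (1 - ρ 0)⁻¹} := by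
  conv_rhs => rw [← hstat a]
  rw [Measure.map_apply (measurable_pi_lambda _ fun x => measurable_pi_apply _)
    (measurableSet_deep 0 _)]
  simp [Atrap]

lemma ofReal_sum_filter {d : ℕ} (s : Finset (Zd d)) (p : Zd d → Prop) (v : Zd d → ℝ)
    (hv : ∀ a, 0 ≤ v a) : ENNReal.ofReal (∑ a ∈ s.filter p, v a)
      = ∑ a ∈ s, if p a then ENNReal.ofReal (v a) else 0 := by
  rw [ENNReal.ofReal_sum_of_nonneg fun a _ => hv a, Finset.sum_filter]

lemma lintegral_sum_ite {d : ℕ} (P : Measure (Zd d → ℝ)) (s : Finset (Zd d))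
    (p : Zd d → (Zd d → ℝ) → Prop) (hp : ∀ a, MeasurableSet {ρ | p a ρ}) (v : Zd d → ℝ≥0∞) :
    ∫⁻ ρ, ∑ a ∈ s, (if p a ρ then v a else 0) ∂P = ∑ a ∈ s, v a * P {ρ | p a ρ} := by
  rw [lintegral_finsetSum _ fun a _ => Measurable.ite (hp a) measurable_const measurable_const]
  refine Finset.sum_congr rfl fun a _ => ?_
  rw [← lintegral_indicator_const (hp a)]
  rfl

lemma exists_lintegral_trap_le {d : ℕ} (hd : d = 3 ∨ d = 4) :
    ∃ C : ℝ, 0 < C ∧ ∀ (P : Measure (Zd d → ℝ)), (∀ᵐ ρ ∂P, ∀ x, ρ x ∈ Set.Ico (0 : ℝ) 1) →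
      (∀ z : Zd d, P.map (fun ρ x => ρ (x + z)) = P) → ∀ (R : ℝ), 0 < R →
      ∀ (m : ℕ) (x : Zd d), x ≠ 0 →
        ∫⁻ ρ, ENNReal.ofReal (∑ a ∈ (lamF d m).filter (· ∈ Atrap R ρ),
          superPot d a * superPot d (x - a)) ∂P
          ≤ ENNReal.ofReal (C / R * radial d (sqn x)) * ∫⁻ ρ, piT ρ 0 ∂P := by
  obtain ⟨C, hC, hsum⟩ := exists_sum_ball_superPot_le hd
  have hu : ∀ x : Zd d, 0 < superPot d x := superPot_pos
  have h4 : 0 < radial d (1 / 4) := radial_pos d (by norm_num)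
  refine ⟨radial d (1 / 4) * C, by positivity, fun P hrange hstat R hR m x hx => ?_⟩
  have hrx : 0 < radial d (sqn x) := radial_pos d (by linarith [one_le_sqn hx])
  have hv : ∀ a, 0 ≤ superPot d a * superPot d (x - a) := fun a => (mul_pos (hu _) (hu _)).le
  calc _ = ∫⁻ ρ, ENNReal.ofReal (∑ a ∈ (lamF d m).filter
        (fun a => R * max (znorm a) 1 ^ 2 ≤ (1 - ρ 0)⁻¹),
          superPot d a * superPot d (x - a)) ∂P := by
        simp only [ofReal_sum_filter _ _ _ hv]
        rw [lintegral_sum_ite P _ (fun a ρ => a ∈ Atrap R ρ) fun a => measurableSet_deep a _,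
          lintegral_sum_ite P _ (fun a ρ => R * max (znorm a) 1 ^ 2 ≤ (1 - ρ 0)⁻¹)
            fun a => measurableSet_deep 0 _]
        exact Finset.sum_congr rfl fun a _ => by rw [measure_mem_Atrap hstat]
    _ ≤ ∫⁻ ρ, ENNReal.ofReal (radial d (1 / 4) * C / R * radial d (sqn x)) * piT ρ 0 ∂P := by
        refine lintegral_mono_ae (hrange.mono fun ρ hρ => ?_)
        have hpos : 0 < (1 - ρ 0)⁻¹ := inv_pos.2 (sub_pos.2 (hρ 0).2)
        rw [piT, ← ENNReal.ofReal_mul (by positivity)]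
        apply ENNReal.ofReal_le_ofReal
        have hfil : (lamF d m).filter (fun a => R * max (znorm a) 1 ^ 2 ≤ (1 - ρ 0)⁻¹)
            = (lamF d m).filter (fun a => max (znorm a) 1 ^ 2 ≤ (1 - ρ 0)⁻¹ / R) := by
          refine Finset.filter_congr fun a _ => ?_
          rw [le_div_iff₀ hR, mul_comm R]
        rw [hfil]
        calc _ ≤ ∑ a ∈ (lamF d m).filter (fun a => max (znorm a) 1 ^ 2 ≤ (1 - ρ 0)⁻¹ / R),
              radial d (1 / 4) * radial d (sqn x) * (superPot d a + superPot d (x - a)) :=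
              Finset.sum_le_sum fun a _ => superPot_mul_le hd hx a
          _ ≤ radial d (1 / 4) * radial d (sqn x) * (C * ((1 - ρ 0)⁻¹ / R)) := by
              rw [← Finset.mul_sum]
              exact mul_le_mul_of_nonneg_left (hsum m x _ (by positivity)) (by positivity)
          _ = _ := by ring
    _ = _ := lintegral_const_mul' _ _ ENNReal.ofReal_ne_top

lemma sq_lt_sqn_of_notMem_lamF {d m : ℕ} {y : Zd d} (hy : y ∉ lamF d m) : (m : ℝ) ^ 2 < sqn y := by
  rw [lamF, Fintype.mem_piFinset, not_forall] at hy
  obtain ⟨i, hi⟩ := hy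
  have h1 : (m : ℤ) < |y i| := by
    rw [Finset.mem_Icc, ← abs_le] at hi
    exact not_le.1 hi
  have h2 : (m : ℝ) < |(y i : ℝ)| := by exact_mod_cast h1
  refine lt_of_lt_of_le ?_ (sq_le_sqn y i)
  rw [← sq_abs (y i : ℝ)]
  gcongr

lemma radial_sixteen_le {d : ℕ} (hd : d = 3 ∨ d = 4) : radial d 16 ≤ 1 / 2 := by
  rcases hd with rfl | rfl
  · rw [radial_three (by norm_num), show (16 : ℝ) = 4 ^ 2 by norm_num,
      Real.sqrt_sq (by norm_num)]
    norm_num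
  · rw [radial_four]
    norm_num

theorem stmt9 (d : ℕ) (hd : d = 3 ∨ d = 4) (P : Measure (Zd d → ℝ))
    [IsProbabilityMeasure P]
    (hrange : ∀ᵐ ρ ∂P, ∀ x, ρ x ∈ Set.Ico (0 : ℝ) 1)
    (hstat : ∀ z : Zd d, P.map (fun ρ x => ρ (x + z)) = P)
    (hint : ∫⁻ ρ, piT ρ 0 ∂P < ∞) :
    ∃ R : ℝ, 0 < R ∧ ∃ c : ℝ, 0 < c ∧ ∃ K : ℕ, 1 ≤ K ∧ ∀ n : ℕ, 2 ≤ n →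
      ∀ x : Zd d, (n : ℝ) / 2 ≤ znorm x → znorm x ≤ n →
        ENNReal.ofReal (c * znorm x ^ ((2 : ℝ) - d)) ≤
          ∫⁻ ρ, gKillTrap ρ R (K * n) 0 x ∂P := by
  obtain ⟨c, C, hc, hC, hlower⟩ := exists_gKillTrap_lower hd
  obtain ⟨C', hC', htrap⟩ := exists_lintegral_trap_le hd
  set I := (∫⁻ ρ, piT ρ 0 ∂P).toReal with hI
  have hI0 : 0 ≤ I := ENNReal.toReal_nonneg
  have hIeq : ∫⁻ ρ, piT ρ 0 ∂P = ENNReal.ofReal I := (ENNReal.ofReal_toReal hint.ne).symm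
  set R : ℝ := 4 * C * C' * (I + 1) / c with hR
  have hR0 : 0 < R := by positivity
  refine ⟨R, hR0, c / 4, by positivity, 5, by norm_num, fun n hn x hx1 hx2 => ?_⟩
  have hn2 : (2 : ℝ) ≤ n := by exact_mod_cast hn
  have hx0 : x ≠ 0 := by
    rintro rfl
    have : znorm (0 : Zd d) = 0 := by simp [znorm]
    linarith
  have hs1 := one_le_sqn hx0
  have hsn : sqn x ≤ (n : ℝ) ^ 2 := by
    rw [← znorm_sq]
    have := znorm_nonneg x
    gcongr
  set φ := radial d (sqn x) with hφ
  have hφ0 : 0 < φ := radial_pos d (by linarith)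
  set b := radial d (16 * (n : ℝ) ^ 2) with hb
  have hb0 : 0 ≤ b := (radial_pos d (by positivity)).le
  have hbd : ∀ y, y ∉ lamF d (5 * n) → subPot d y ≤ b := fun y hy => by
    have h := sq_lt_sqn_of_notMem_lamF hy
    push_cast at h
    rw [subPot, if_pos (by nlinarith)]
    exact radial_anti hd (by positivity) (by nlinarith)
  have hbφ : b ≤ φ / 2 := by
    rw [hb, radial_mul d (by norm_num) (by positivity)]
    have h1 : radial d ((n : ℝ) ^ 2) ≤ φ := radial_anti hd (by linarith) hsn
    have h2 := mul_le_mul (radial_sixteen_le hd) h1 (radial_pos d (by positivity)).le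
      (by norm_num : (0 : ℝ) ≤ 1 / 2)
    linarith
  have hwφ : φ ≤ subPot d x := radial_le_subPot hd hs1 (by linarith)
  have hmain : ENNReal.ofReal (c / 2 * φ) ≤ ∫⁻ ρ, gKillTrap ρ R (5 * n) 0 x ∂P
      + ENNReal.ofReal (c / 4 * φ) := by
    calc ENNReal.ofReal (c / 2 * φ) ≤ ENNReal.ofReal (c * (subPot d x - b)) := by
          apply ENNReal.ofReal_le_ofReal
          have := mul_le_mul_of_nonneg_left (by linarith : φ / 2 ≤ subPot d x - b) hc.le
          linarith
      _ = ∫⁻ _, ENNReal.ofReal (c * (subPot d x - b)) ∂P := by simp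
      _ ≤ ∫⁻ ρ, (gKillTrap ρ R (5 * n) 0 x + ENNReal.ofReal C * ENNReal.ofReal
            (∑ a ∈ (lamF d (5 * n)).filter (· ∈ Atrap R ρ),
              superPot d a * superPot d (x - a))) ∂P := by
          refine lintegral_mono_ae (hrange.mono fun ρ hρ => ?_)
          rw [← ENNReal.ofReal_mul hC.le]
          exact hlower ρ hρ R (5 * n) b hb0 hbd x
      _ = ∫⁻ ρ, gKillTrap ρ R (5 * n) 0 x ∂P + ENNReal.ofReal C * ∫⁻ ρ, ENNReal.ofReal
            (∑ a ∈ (lamF d (5 * n)).filter (· ∈ Atrap R ρ),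
              superPot d a * superPot d (x - a)) ∂P := by
          rw [lintegral_add_right, lintegral_const_mul' _ _ ENNReal.ofReal_ne_top]
          refine Measurable.const_mul ?_ _
          simp only [ofReal_sum_filter _ _ _ fun a =>
            (mul_pos (superPot_pos a) (superPot_pos (x - a))).le]
          exact Finset.measurable_sum _ fun a _ => Measurable.ite (measurableSet_deep a _)
            measurable_const measurable_const
      _ ≤ ∫⁻ ρ, gKillTrap ρ R (5 * n) 0 x ∂P
            + ENNReal.ofReal C * (ENNReal.ofReal (C' / R * φ) * ENNReal.ofReal I) := by
          gcongr
          rw [← hIeq]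
          exact htrap P hrange hstat R hR0 (5 * n) x hx0
      _ ≤ _ := by
          gcongr
          rw [← ENNReal.ofReal_mul (by positivity), ← ENNReal.ofReal_mul hC.le]
          apply ENNReal.ofReal_le_ofReal
          have e : C * (C' / R * φ * I) = c / 4 * φ * (I / (I + 1)) := by
            rw [hR]
            field_simp
          rw [e]
          exact mul_le_of_le_one_right (by positivity)
            ((div_le_one (by linarith)).2 (by linarith))
  have hsplit : ENNReal.ofReal (c / 2 * φ)
      = ENNReal.ofReal (c / 4 * φ) + ENNReal.ofReal (c / 4 * φ) := by
    rw [← ENNReal.ofReal_add (by positivity) (by positivity)]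
    congr 1
    ring
  rw [hsplit] at hmain
  have hfin := (ENNReal.add_le_add_iff_right ENNReal.ofReal_ne_top).1 hmain
  rwa [hφ, ← znorm_sq, radial_sq (znorm_nonneg x)] at hfin
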